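/- Let u, v : ℝ² → ℂ be continuously differentiable, let λ ∈ ℂ∖{0}, and set k := λ⁻². If φ : ℝ² → M₂(ℂ) is differentiable and satisfies the λ-Lax pair ∂_x φ − (i/4)(λ²−λ⁻²)[σ₃,φ] = Q(x,t,λ)φ and ∂_t φ − (i/4)(λ²+λ⁻²)[σ₃,φ] = P(x,t,λ)φ, then the gauge-transformed function Φ(x,t) := T(x,t)φ(x,t), where T(x,t) := [[1,0],[u(x,t), λ⁻¹]], satisfies the k-Lax pair ∂_x Φ − (i/4)(k⁻¹−k)[σ₃,Φ] = U(x,t,k)Φ and ∂_t Φ − (i/4)(k⁻¹+k)[σ₃,Φ] = V(x,t,k)Φ. -/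

import Mathlib

open Complex Matrix

noncomputable section

abbrev M2 : Type := Matrix (Fin 2) (Fin 2) ℂ

/-- partial derivative in `x` (first coordinate). -/
def pdx (f : ℝ × ℝ → ℂ) (p : ℝ × ℝ) : ℂ := fderiv ℝ f p (1, 0)

/-- partial derivative in `t` (second coordinate). -/
def pdt (f : ℝ × ℝ → ℂ) (p : ℝ × ℝ) : ℂ := fderiv ℝ f p (0, 1)

/-- entrywise partial derivative in `x` of a matrix-valued function. -/
def Mdx (M : ℝ × ℝ → M2) (p : ℝ × ℝ) : M2 := Matrix.of fun i j => pdx (fun q => M q i j) p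

/-- entrywise partial derivative in `t` of a matrix-valued function. -/
def Mdt (M : ℝ × ℝ → M2) (p : ℝ × ℝ) : M2 := Matrix.of fun i j => pdt (fun q => M q i j) p

def sigma3 : M2 := !![1, 0; 0, -1]

/-- matrix commutator. -/
def mcomm (A B : M2) : M2 := A * B - B * A

/-- `|w|²` as a complex number. -/
def nsq (w : ℂ) : ℂ := (Complex.normSq w : ℂ)

/-- complex conjugation. -/
def cj (w : ℂ) : ℂ := (starRingEnd ℂ) w

/-- the massive Thirring system. -/
def MTsys (u v : ℝ × ℝ → ℂ) : Prop :=
  ∀ p : ℝ × ℝ,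
    Complex.I * (pdt u p + pdx u p) + v p + nsq (v p) * u p = 0 ∧
    Complex.I * (pdt v p - pdx v p) + u p + nsq (u p) * v p = 0

/-- the matrix `Q(x,t,λ)` of the λ-Lax pair. -/
def Qmat (u v : ℝ × ℝ → ℂ) (l : ℂ) (p : ℝ × ℝ) : M2 :=
  (Complex.I / 4 * (nsq (u p) - nsq (v p))) • sigma3
    - (Complex.I * l / 2) • !![0, cj (v p); v p, 0]
    + (Complex.I / (2 * l)) • !![0, cj (u p); u p, 0]

/-- the matrix `P(x,t,λ)` of the λ-Lax pair. -/
def Pmat (u v : ℝ × ℝ → ℂ) (l : ℂ) (p : ℝ × ℝ) : M2 :=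
  (-(Complex.I / 4) * (nsq (u p) + nsq (v p))) • sigma3
    - (Complex.I * l / 2) • !![0, cj (v p); v p, 0]
    - (Complex.I / (2 * l)) • !![0, cj (u p); u p, 0]

def U1m (u v : ℝ × ℝ → ℂ) (p : ℝ × ℝ) : M2 :=
  !![-(Complex.I/4) * (nsq (u p) + nsq (v p)), (Complex.I/2) * cj (u p);
     pdx u p - (Complex.I/2) * u p * nsq (v p) - (Complex.I/2) * v p,
     (Complex.I/4) * (nsq (u p) + nsq (v p))]

def U2m (u v : ℝ × ℝ → ℂ) (p : ℝ × ℝ) : M2 :=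
  !![u p * cj (v p), -cj (v p);
     u p + (u p)^2 * cj (v p), -(u p * cj (v p))]

def V1m (u v : ℝ × ℝ → ℂ) (p : ℝ × ℝ) : M2 :=
  !![(Complex.I/4) * (nsq (u p) - nsq (v p)), -(Complex.I/2) * cj (u p);
     pdt u p - (Complex.I/2) * u p * nsq (v p) - (Complex.I/2) * v p,
     -((Complex.I/4) * (nsq (u p) - nsq (v p)))]

/-- the matrix `U(x,t,k)` of the k-Lax pair. -/
def Umat (u v : ℝ × ℝ → ℂ) (k : ℂ) (p : ℝ × ℝ) : M2 :=
  U1m u v p + (Complex.I/(2*k)) • U2m u v p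

/-- the matrix `V(x,t,k)` of the k-Lax pair. -/
def Vmat (u v : ℝ × ℝ → ℂ) (k : ℂ) (p : ℝ × ℝ) : M2 :=
  V1m u v p + (Complex.I/(2*k)) • U2m u v p

theorem pdx_gauge (u a b : ℝ × ℝ → ℂ) (l : ℂ) (hu : Differentiable ℝ u)
    (ha : Differentiable ℝ a) (hb : Differentiable ℝ b) (p : ℝ × ℝ) :
    pdx (fun q => u q * a q + l * b q) p = pdx u p * a p + u p * pdx a p + l * pdx b p := by
  have h := (((hu p).hasFDerivAt.mul (ha p).hasFDerivAt).add
    ((hb p).hasFDerivAt.const_mul l)).fderiv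
  have h2 := congrArg (fun L => L (1, 0)) h
  simp only [_root_.add_apply, _root_.smul_apply, smul_eq_mul] at h2
  refine Eq.trans h2 ?_
  simp only [pdx]
  ring

theorem pdt_gauge (u a b : ℝ × ℝ → ℂ) (l : ℂ) (hu : Differentiable ℝ u)
    (ha : Differentiable ℝ a) (hb : Differentiable ℝ b) (p : ℝ × ℝ) :
    pdt (fun q => u q * a q + l * b q) p = pdt u p * a p + u p * pdt a p + l * pdt b p := by
  have h := (((hu p).hasFDerivAt.mul (ha p).hasFDerivAt).add
    ((hb p).hasFDerivAt.const_mul l)).fderiv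
  have h2 := congrArg (fun L => L (0, 1)) h
  simp only [_root_.add_apply, _root_.smul_apply, smul_eq_mul] at h2
  refine Eq.trans h2 ?_
  simp only [pdt]
  ring

theorem nsq_eq (w : ℂ) : nsq w = w * cj w := (Complex.mul_conj w).symm

/-- the gauge transformation `Φ = T φ`, `T = [[1,0],[u,λ⁻¹]]`, maps
solutions of the λ-Lax pair to solutions of the k-Lax pair with `k = λ⁻²`. -/
theorem gauge_lambda_to_k
    (u v : ℝ × ℝ → ℂ) (hu : ContDiff ℝ 1 u) (hv : ContDiff ℝ 1 v)
    (l : ℂ) (hl : l ≠ 0) (φ : ℝ × ℝ → M2)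
    (hφ : ∀ i j, Differentiable ℝ fun p => φ p i j)
    (hLx : ∀ p : ℝ × ℝ,
      Mdx φ p - (Complex.I / 4 * (l ^ 2 - (l ^ 2)⁻¹)) • mcomm sigma3 (φ p)
        = Qmat u v l p * φ p)
    (hLt : ∀ p : ℝ × ℝ,
      Mdt φ p - (Complex.I / 4 * (l ^ 2 + (l ^ 2)⁻¹)) • mcomm sigma3 (φ p)
        = Pmat u v l p * φ p) :
    let k : ℂ := (l ^ 2)⁻¹
    let Φ : ℝ × ℝ → M2 := fun q => !![1, 0; u q, l⁻¹] * φ q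
    (∀ p : ℝ × ℝ,
        Mdx Φ p - (Complex.I / 4 * (k⁻¹ - k)) • mcomm sigma3 (Φ p)
          = Umat u v k p * Φ p) ∧
    (∀ p : ℝ × ℝ,
        Mdt Φ p - (Complex.I / 4 * (k⁻¹ + k)) • mcomm sigma3 (Φ p)
          = Vmat u v k p * Φ p) := by
  intro k Φ
  have hud : Differentiable ℝ u := hu.differentiable (by norm_num)
  refine ⟨fun p => ?_, fun p => ?_⟩
  · simp only [k, Φ]
    have h00 := congrFun (congrFun (hLx p) 0) 0
    have h01 := congrFun (congrFun (hLx p) 0) 1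
    have h10 := congrFun (congrFun (hLx p) 1) 0
    have h11 := congrFun (congrFun (hLx p) 1) 1
    simp [-Matrix.cons_mul, Mdx, Qmat, mcomm, sigma3, Matrix.mul_apply, Fin.sum_univ_two, nsq_eq] at h00 h01 h10 h11
    rw [sub_eq_iff_eq_add] at h01 h10
    ext i j
    fin_cases i <;> fin_cases j <;>
      simp [-Matrix.cons_mul, Mdx, Umat, U1m, U2m, mcomm, sigma3, Matrix.mul_apply, Fin.sum_univ_two, nsq_eq,
        pdx_gauge u _ _ _ hud (hφ _ _) (hφ _ _), h00, h01, h10, h11] <;>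
      field_simp <;> ring
  · simp only [k, Φ]
    have h00 := congrFun (congrFun (hLt p) 0) 0
    have h01 := congrFun (congrFun (hLt p) 0) 1
    have h10 := congrFun (congrFun (hLt p) 1) 0
    have h11 := congrFun (congrFun (hLt p) 1) 1
    simp [-Matrix.cons_mul, Mdt, Pmat, mcomm, sigma3, Matrix.mul_apply, Fin.sum_univ_two, nsq_eq] at h00 h01 h10 h11
    rw [sub_eq_iff_eq_add] at h01 h10
    ext i j
    fin_cases i <;> fin_cases j <;>
      simp [-Matrix.cons_mul, Mdt, Vmat, V1m, U2m, mcomm, sigma3, Matrix.mul_apply, Fin.sum_univ_two, nsq_eq,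
        pdt_gauge u _ _ _ hud (hφ _ _) (hφ _ _), h00, h01, h10, h11] <;>
      field_simp <;> ring
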